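/- Splitting computes the assumption meet exactly on the applicable branch: let Σ be a meet-semilattice, a ∈ 𝒜, π_a ∈ Σ, and let X be a parameterized state with the partition property. Then for every subset A of 𝒜, every rule (φ, σ) ∈ X with A ∈ φ, and every rule (φ', σ') ∈ split_a(X) with A ∈ φ': if a ∈ A then σ' = σ ⊓ π_a, and if a ∉ A then σ' = σ. -/

import Mathlib

/-- Partition property: every `A ⊆ 𝒜` belongs to the condition of exactly one
rule. -/
def PartitionProp {𝒜 St : Type*} (X : Set (Set (Set 𝒜) × St)) : Prop :=
  ∀ A : Set 𝒜, ∃! r : Set (Set 𝒜) × St, r ∈ X ∧ A ∈ r.1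

/-- The split of a parameterized state `X` on the assumption `a` with
associated state `πa`. -/
def splitOn {𝒜 St : Type*} [SemilatticeInf St] (a : 𝒜) (πa : St)
    (X : Set (Set (Set 𝒜) × St)) : Set (Set (Set 𝒜) × St) :=
  {p | ∃ r ∈ X, r.1 ∩ {A : Set 𝒜 | a ∈ A} ≠ ∅ ∧
        p = (r.1 ∩ {A : Set 𝒜 | a ∈ A}, r.2 ⊓ πa)} ∪
  {p | ∃ r ∈ X, r.1 ∩ {A : Set 𝒜 | a ∉ A} ≠ ∅ ∧
        p = (r.1 ∩ {A : Set 𝒜 | a ∉ A}, r.2)}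

/-- **Splitting computes the assumption meet exactly on the applicable
branch.** -/
theorem splitOn_semantics {𝒜 St : Type*} [SemilatticeInf St]
    (a : 𝒜) (πa : St) (X : Set (Set (Set 𝒜) × St)) (hX : PartitionProp X) :
    ∀ A : Set 𝒜, ∀ φ σ, (φ, σ) ∈ X → A ∈ φ →
      ∀ φ' σ', (φ', σ') ∈ splitOn a πa X → A ∈ φ' →
        (a ∈ A → σ' = σ ⊓ πa) ∧ (a ∉ A → σ' = σ) := by
  rintro A φ σ hφ hA φ' σ' (⟨r, hr, -, h⟩ | ⟨r, hr, -, h⟩) hA'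
  all_goals
    obtain ⟨rfl, rfl⟩ := Prod.mk.inj h
    obtain ⟨hAr, ha⟩ := hA'
    obtain rfl : r = (φ, σ) := (hX A).unique ⟨hr, hAr⟩ ⟨hφ, hA⟩
  · exact ⟨fun _ => rfl, fun h => absurd ha h⟩
  · exact ⟨fun h => absurd h ha, fun _ => rfl⟩
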